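/- Consider the 3-user MISO BC with hybrid CSIT in which receiver 3 has CSIT state I_3 = D (receivers 1 and 2 may have any CSIT states). For every decodable linear coding strategy of block length n, almost surely m_1(n) + (1/2)·m_2(n) + 2·m_3(n) ≤ 2n. -/

import Mathlib

open MeasureTheory Matrix Filter Topology

noncomputable section

/-- CSIT state of a receiver: instantaneous (`P`), delayed (`D`), or none (`N`). -/
inductive CSITState : Type
  | P : CSITState
  | D : CSITState
  | N : CSITState
  deriving DecidableEq

/-- A channel realization: for each receiver `j`, time slot `t` and transmit antenna `a`,
the channel coefficient `g j t a`. -/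
abbrev Chan (k m n : ℕ) : Type := Fin k → Fin n → Fin m → ℂ

/-- Joint law of the channel coefficients: all entries i.i.d. with common law `μ`. -/
def chanMeasure (k m n : ℕ) (μ : Measure ℂ) : Measure (Chan k m n) :=
  Measure.pi fun _ : Fin k => Measure.pi fun _ : Fin n => Measure.pi fun _ : Fin m => μ

/-- The block-diagonal channel matrix `G_j^n ∈ ℂ^{n × nm}` of a receiver with
channel vectors `g (t) ∈ ℂ^{1 × m}`. -/
def blockDiag {m n : ℕ} (g : Fin n → Fin m → ℂ) : Matrix (Fin n) (Fin n × Fin m) ℂ :=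
  Matrix.of fun t p => if p.1 = t then g t p.2 else 0

/-- A linear coding strategy of block length `n` for the `k`-user MISO BC with `m`
transmit antennas and hybrid CSIT configuration `I`. -/
structure Strategy (k m n : ℕ) (I : Fin k → CSITState) : Type where
  /-- number of information symbols `m_j(n)` for receiver `j` -/
  dim : Fin k → ℕ
  /-- precoding matrix `V_j(t) ∈ ℂ^{m × m_j(n)}`, a function of the channel realization -/
  pre : (j : Fin k) → Fin n → Chan k m n → Matrix (Fin m) (Fin (dim j)) ℂ
  /-- each precoder is a measurable function of the channels -/
  meas : ∀ j t a c, Measurable fun g => pre j t g a c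
  /-- `V_j(t)` depends only on the CSIT available at time `t`: current and past channels of
  receivers with instantaneous CSIT, and strictly past channels of receivers with delayed
  CSIT (and nothing from receivers with no CSIT). -/
  causal : ∀ (j : Fin k) (t : Fin n) (g g' : Chan k m n),
    (∀ i, I i = CSITState.P → ∀ s : Fin n, (s : ℕ) ≤ (t : ℕ) → g i s = g' i s) →
    (∀ i, I i = CSITState.D → ∀ s : Fin n, (s : ℕ) < (t : ℕ) → g i s = g' i s) →
    pre j t g = pre j t g'

namespace Strategy

variable {k m n : ℕ} {I : Fin k → CSITState}

/-- The overall precoding matrix `V_j^n ∈ ℂ^{nm × m_j(n)}` (vertical concatenation of the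
`V_j(t)`). -/
def Vn (f : Strategy k m n I) (j : Fin k) (g : Chan k m n) :
    Matrix (Fin n × Fin m) (Fin (f.dim j)) ℂ :=
  Matrix.of fun r c => f.pre j r.1 g r.2 c

/-- Horizontal concatenation `[∪_{i ∈ S} V_i^n]` of the precoding matrices of the
receivers in `S`. -/
def VS (f : Strategy k m n I) (S : Finset (Fin k)) (g : Chan k m n) :
    Matrix (Fin n × Fin m) ((i : {x // x ∈ S}) × Fin (f.dim i.1)) ℂ :=
  Matrix.of fun r c => f.Vn c.1.1 g r c.2

/-- The received-signal matrix `G_j^n [∪_{i ∈ S} V_i^n]` at receiver `j`. -/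
def recvS (f : Strategy k m n I) (S : Finset (Fin k)) (j : Fin k) (g : Chan k m n) :
    Matrix (Fin n) ((i : {x // x ∈ S}) × Fin (f.dim i.1)) ℂ :=
  blockDiag (g j) * f.VS S g

/-- The received-signal matrix `G_j^n V_j^n` at receiver `j` from its own precoder. -/
def recv1 (f : Strategy k m n I) (j : Fin k) (g : Chan k m n) :
    Matrix (Fin n) (Fin (f.dim j)) ℂ :=
  blockDiag (g j) * f.Vn j g

/-- `G_j^t [∪_{i ∈ S} V_i^t]`: the received signal matrix restricted to the first `t`
time slots (rows beyond `t` set to zero, so that its rank is that of the truncated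
matrix, with the `t = 0` convention of rank `0`). -/
def recvUpTo (f : Strategy k m n I) (S : Finset (Fin k)) (j : Fin k)
    (g : Chan k m n) (t : ℕ) :
    Matrix (Fin n) ((i : {x // x ∈ S}) × Fin (f.dim i.1)) ℂ :=
  Matrix.of fun s c => if (s : ℕ) < t then f.recvS S j g s c else 0

/-- Decodability: for every receiver `j`, almost surely
`rank[G_j^n[∪_i V_i^n]] − rank[G_j^n[∪_{i ≠ j} V_i^n]] = rank[G_j^n V_j^n] = m_j(n)`. -/
def Decodable (f : Strategy k m n I) (μ : Measure ℂ) : Prop :=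
  ∀ j : Fin k, ∀ᵐ g ∂ chanMeasure k m n μ,
    (f.recvS Finset.univ j g).rank - (f.recvS (Finset.univ.erase j) j g).rank
        = (f.recv1 j g).rank ∧
    (f.recv1 j g).rank = f.dim j

end Strategy

/-- A DoF tuple is linearly achievable if there is a sequence of decodable strategies
achieving it in the limit. -/
def LinAchievable (k m : ℕ) (I : Fin k → CSITState) (μ : Measure ℂ) (d : Fin k → ℝ) : Prop :=
  (∀ j, 0 ≤ d j ∧ d j ≤ 1) ∧
  ∃ F : (n : ℕ) → Strategy k m n I,
    (∀ n, (F n).Decodable μ) ∧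
    ∀ j, Tendsto (fun n : ℕ => ((F n).dim j : ℝ) / n) atTop (nhds (d j))

/-- The linear degrees-of-freedom region: closure of the set of linearly achievable tuples. -/
def LDoFRegion (k m : ℕ) (I : Fin k → CSITState) (μ : Measure ℂ) : Set (Fin k → ℝ) :=
  closure {d | LinAchievable k m I μ d}

/-- The linear sum degrees of freedom. -/
def LDoFSum (k m : ℕ) (I : Fin k → CSITState) (μ : Measure ℂ) : ℝ :=
  sSup ((fun d => ∑ j, d j) '' LDoFRegion k m I μ)

/-- The set `𝒫` of receivers supplying instantaneous CSIT. -/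
def stateP (k : ℕ) (I : Fin k → CSITState) : Finset (Fin k) :=
  Finset.univ.filter fun i => I i = CSITState.P

/-- The set `𝒟` of receivers supplying delayed CSIT. -/
def stateD (k : ℕ) (I : Fin k → CSITState) : Finset (Fin k) :=
  Finset.univ.filter fun i => I i = CSITState.D

/-- The set `𝒩` of receivers supplying no CSIT. -/
def stateN (k : ℕ) (I : Fin k → CSITState) : Finset (Fin k) :=
  Finset.univ.filter fun i => I i = CSITState.N


section Measurability

/-- A property of a random vector with independent coordinates holds almost surely as soon as it
holds almost surely when only one coordinate is random. -/
lemma ae_pi_of_ae_update {ι : Type*} [Fintype ι] [DecidableEq ι] {α : ι → Type*}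
    [∀ i, MeasurableSpace (α i)] {ν : ∀ i, Measure (α i)} [∀ i, IsProbabilityMeasure (ν i)]
    (i : ι) {P : (∀ i, α i) → Prop} (hP : MeasurableSet {x | P x})
    (h : ∀ x, ∀ᵐ y ∂ν i, P (Function.update x i y)) : ∀ᵐ x ∂Measure.pi ν, P x := by
  have hm : Measurable fun p : (∀ i, α i) × α i => Function.update p.1 i p.2 := by
    refine measurable_pi_lambda _ fun j => ?_
    by_cases hj : j = i
    · subst hj; simpa using measurable_snd
    · simpa [Function.update_of_ne hj] using! (measurable_pi_apply j).comp measurable_fst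
  have hmap : ((Measure.pi ν).prod (ν i)).map (fun p => Function.update p.1 i p.2)
      = Measure.pi ν := by
    refine (Measure.pi_eq fun s hs => ?_).symm
    rw [Measure.map_apply hm (MeasurableSet.univ_pi hs)]
    have hpre : (fun p : (∀ i, α i) × α i => Function.update p.1 i p.2) ⁻¹' Set.univ.pi s
        = Set.univ.pi (Function.update s i Set.univ) ×ˢ s i := by
      ext ⟨x, y⟩
      simp only [Set.mem_preimage, Set.mem_univ_pi, Set.mem_prod]
      constructor
      · refine fun hx => ⟨fun j => ?_, by simpa using hx i⟩
        by_cases hj : j = i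
        · subst hj; simp
        · simpa [Function.update_of_ne hj] using hx j
      · rintro ⟨hx, hy⟩ j
        by_cases hj : j = i
        · subst hj; simpa using hy
        · simpa [Function.update_of_ne hj] using hx j
    rw [hpre, Measure.prod_prod, Measure.pi_pi,
      ← Finset.prod_erase_mul _ _ (Finset.mem_univ i), ← Finset.prod_erase_mul _ (fun j => ν j (s j))
        (Finset.mem_univ i)]
    simp only [Function.update_self, measure_univ, mul_one]
    congr 1
    refine Finset.prod_congr rfl fun j hj => ?_
    rw [Function.update_of_ne (Finset.ne_of_mem_erase hj)]
  rw [← hmap, ae_map_iff hm.aemeasurable hP]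
  exact (Measure.ae_prod_iff_ae_ae (hm hP)).2 (Eventually.of_forall h)

lemma mem_span_range_iff_exists_not_linearIndependent {K V ι : Type*} [DivisionRing K]
    [AddCommGroup V] [Module K V] (v : V) (w : ι → V) :
    v ∈ Submodule.span K (Set.range w) ↔
      ∃ T : Set ι, LinearIndependent K (fun i : T => w i) ∧
        ¬ LinearIndependent K (fun o : Option T => o.elim v fun i => w i) := by
  have key : ∀ T : Set ι, LinearIndependent K (fun i : T => w i) →
      (¬ LinearIndependent K (fun o : Option T => o.elim v fun i => w i) ↔
        v ∈ Submodule.span K (Set.range fun i : T => w i)) := by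
    intro T hT
    rw [linearIndependent_option]
    simp only [Option.elim_none, not_and_not_right, Function.comp_def, Option.elim_some]
    exact ⟨fun h => h hT, fun h _ => h⟩
  constructor
  · intro hv
    obtain ⟨κ, a, ha, hsp, hli⟩ := exists_linearIndependent' K w
    have hT : LinearIndependent K (fun i : Set.range a => w i) :=
      (linearIndependent_equiv' (Equiv.ofInjective a ha) rfl).1 hli
    refine ⟨Set.range a, hT, (key _ hT).2 ?_⟩
    rwa [← Set.image_eq_range, ← Set.range_comp, hsp]
  · rintro ⟨T, hT, hv⟩
    refine Submodule.span_mono ?_ ((key T hT).1 hv)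
    rintro _ ⟨i, rfl⟩
    exact ⟨i, rfl⟩

lemma measurableSet_mem_span {α ι κ : Type*} [MeasurableSpace α] [Finite ι] [Finite κ]
    {v : α → κ → ℂ} {w : α → ι → κ → ℂ} (hv : Measurable v) (hw : ∀ i, Measurable fun x => w x i) :
    MeasurableSet {x | v x ∈ Submodule.span ℂ (Set.range (w x))} := by
  have := Fintype.ofFinite κ
  have hli : ∀ {β : Type _} [Finite β] (u : α → β → κ → ℂ), (∀ b, Measurable fun x => u x b) →
      MeasurableSet {x | LinearIndependent ℂ (u x)} := fun {β} _ u hu => by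
    have := Fintype.ofFinite β
    exact (isOpen_setOfPred_linearIndependent (𝕜 := ℂ) (E := κ → ℂ) (ι := β)).measurableSet.preimage
      (measurable_pi_lambda u hu)
  simp only [mem_span_range_iff_exists_not_linearIndependent, Set.ofPred_exists]
  refine MeasurableSet.iUnion fun T => MeasurableSet.inter (hli (fun x (i : T) => w x i) fun i => hw i)
    (hli (fun x (o : Option T) => o.elim (v x) fun i => w x i) fun o => ?_).compl
  cases o with
  | none => exact hv
  | some i => exact hw i

end Measurability

section LinearAlgebra

variable {K V W : Type*} [DivisionRing K] [AddCommGroup V] [Module K V]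
  [AddCommGroup W] [Module K W]

open Module

/-- If the rows `v s` all lie in the span of the previous `u r` whenever `u s` does, then adjoining
to the `u s` one combination `w s` of each group of rows `v s` at most doubles the dimension. -/
lemma finrank_span_union_le_two_mul {n : ℕ} {ι : Type*} (u w : Fin n → V) (v : Fin n → ι → V)
    (hw : ∀ s, w s ∈ Submodule.span K (Set.range (v s)))
    (h : ∀ s, u s ∈ Submodule.span K (u '' Set.Iio s) →
      ∀ a, v s a ∈ Submodule.span K (u '' Set.Iio s)) :
    finrank K (Submodule.span K (Set.range u ∪ Set.range w)) ≤
      2 * finrank K (Submodule.span K (Set.range u)) := by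
  have key : ∀ t : ℕ, t ≤ n →
      finrank K (Submodule.span K (u '' {s | (s : ℕ) < t} ∪ w '' {s | (s : ℕ) < t})) ≤
        2 * finrank K (Submodule.span K (u '' {s | (s : ℕ) < t})) := by
    intro t
    induction t with
    | zero =>
      have h0 : {s : Fin n | (s : ℕ) < 0} = ∅ := by ext; simp
      rw [h0, Set.image_empty, Set.image_empty, Set.union_empty, Submodule.span_empty, finrank_bot]
      exact fun _ => Nat.zero_le _
    | succ t ih =>
      intro ht
      have ih := ih (by omega)
      set s : Fin n := ⟨t, ht⟩
      have hset : {r : Fin n | (r : ℕ) < t + 1} = insert s {r : Fin n | (r : ℕ) < t} := by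
        ext r; simp [s, Fin.ext_iff]; omega
      have hIio : Set.Iio s = {r : Fin n | (r : ℕ) < t} := by
        ext r; simp [s, Fin.lt_def]
      have hs := h s
      rw [hIio] at hs
      rw [hset, Set.image_insert_eq, Set.image_insert_eq]
      set A := u '' {r : Fin n | (r : ℕ) < t}
      set B := w '' {r : Fin n | (r : ℕ) < t}
      have hAfin : A.Finite := (Set.toFinite _).image _
      have hBfin : B.Finite := (Set.toFinite _).image _
      have : FiniteDimensional K (Submodule.span K A) := FiniteDimensional.span_of_finite K hAfin
      have : FiniteDimensional K (Submodule.span K (A ∪ B)) :=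
        FiniteDimensional.span_of_finite K (hAfin.union hBfin)
      have : FiniteDimensional K (Submodule.span K (insert (u s) A)) :=
        FiniteDimensional.span_of_finite K (hAfin.insert _)
      by_cases hu : u s ∈ Submodule.span K A
      · have hws : w s ∈ Submodule.span K A :=
          Submodule.span_le.2 (by rintro _ ⟨a, rfl⟩; exact hs hu a) (hw s)
        have hA : A ⊆ A ∪ B := Set.subset_union_left
        rw [Set.insert_union, Set.union_insert,
          Submodule.span_insert_eq_span
            (Submodule.span_mono (hA.trans (Set.subset_insert _ _)) hu),
          Submodule.span_insert_eq_span (Submodule.span_mono hA hws),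
          Submodule.span_insert_eq_span hu]
        exact ih
      · have h1 : finrank K (Submodule.span K A) + 1 ≤
            finrank K (Submodule.span K (insert (u s) A)) := by
          refine Submodule.finrank_lt_finrank_of_lt
            (SetLike.lt_iff_le_and_exists.2 ⟨Submodule.span_mono (Set.subset_insert _ _),
            u s, Submodule.subset_span (Set.mem_insert _ _), hu⟩)
        have h2 : finrank K (Submodule.span K (insert (u s) A ∪ insert (w s) B)) ≤
            finrank K (Submodule.span K (A ∪ B)) + 2 := by
          have hsp : Submodule.span K (insert (u s) A ∪ insert (w s) B) =
              Submodule.span K (A ∪ B) ⊔ Submodule.span K ({u s} ⊔ {w s}) := by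
            rw [← Submodule.span_union]
            congr 1
            ext x
            simp only [Set.mem_union, Set.mem_insert_iff, Set.sup_eq_union, Set.mem_singleton_iff]
            tauto
          have : FiniteDimensional K (Submodule.span K ({u s} ⊔ {w s} : Set V)) :=
            FiniteDimensional.span_of_finite K (by simp)
          rw [hsp]
          refine (Submodule.finrank_add_le_finrank_add_finrank _ _).trans ?_
          gcongr
          have := finrank_range_le_card (R := K) ![u s, w s]
          rw [Set.finrank, Matrix.range_cons, Matrix.range_cons, Matrix.range_empty,
            Set.union_empty] at this
          simpa using! this
        omega
  have hn := key n le_rfl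
  have huniv : {s : Fin n | (s : ℕ) < n} = Set.univ := by ext s; simp
  rwa [huniv, Set.image_univ, Set.image_univ] at hn

variable [FiniteDimensional K V]

lemma Submodule.finrank_sup_add_finrank_le (A B C : Submodule K V) :
    finrank K ↥(A ⊔ B ⊔ C) + finrank K B ≤ finrank K ↥(A ⊔ B) + finrank K ↥(B ⊔ C) := by
  have h := Submodule.finrank_sup_add_finrank_inf_eq (A ⊔ B) (B ⊔ C)
  have h1 : A ⊔ B ⊔ (B ⊔ C) = A ⊔ B ⊔ C := by rw [← sup_assoc, sup_assoc A B B, sup_idem]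
  have h2 : finrank K B ≤ finrank K ↥((A ⊔ B) ⊓ (B ⊔ C)) :=
    Submodule.finrank_mono (le_inf le_sup_right le_sup_left)
  rw [h1] at h
  omega

lemma Submodule.finrank_map_add_finrank_le {A B : Submodule K V} (hBA : B ≤ A) (f : V →ₗ[K] W) :
    finrank K (A.map f) + finrank K B ≤ finrank K A + finrank K (B.map f) := by
  have hA := LinearMap.finrank_range_add_finrank_ker (f.domRestrict A)
  have hB := LinearMap.finrank_range_add_finrank_ker (f.domRestrict B)
  rw [LinearMap.range_domRestrict] at hA hB
  have hker : finrank K (LinearMap.ker (f.domRestrict B)) ≤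
      finrank K (LinearMap.ker (f.domRestrict A)) := by
    refine LinearMap.finrank_le_finrank_of_injective
      (f := (Submodule.inclusion hBA).restrict (p := LinearMap.ker (f.domRestrict B))
        (q := LinearMap.ker (f.domRestrict A)) fun x hx => hx) fun x y hxy => ?_
    exact Subtype.ext (Submodule.inclusion_injective hBA (congrArg Subtype.val hxy))
  omega

end LinearAlgebra

namespace Strategy

variable {k m n : ℕ} {I : Fin k → CSITState}

/-- The span of the columns of the precoding matrices of the receivers in `S`. -/
def beams (f : Strategy k m n I) (S : Finset (Fin k)) (g : Chan k m n) :
    Submodule ℂ (Fin n × Fin m → ℂ) :=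
  LinearMap.range (f.VS S g).mulVecLin

lemma beams_union (f : Strategy k m n I) (S T : Finset (Fin k)) (g : Chan k m n) :
    f.beams (S ∪ T) g = f.beams S g ⊔ f.beams T g := by
  have hspan : ∀ S, f.beams S g =
      Submodule.span ℂ {x | ∃ i ∈ S, ∃ c, x = fun r => f.Vn i g r c} := by
    intro S
    rw [beams, Matrix.range_mulVecLin]
    congr 1
    ext x
    constructor
    · rintro ⟨⟨i, c⟩, rfl⟩
      exact ⟨i.1, i.2, c, rfl⟩
    · rintro ⟨i, hi, c, rfl⟩
      exact ⟨⟨⟨i, hi⟩, c⟩, rfl⟩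
  rw [hspan, hspan, hspan, ← Submodule.span_union]
  congr 1
  ext x
  simp only [Finset.mem_union, Set.mem_ofPred_eq, Set.mem_union, or_and_right, exists_or]

lemma rank_mul_VS (f : Strategy k m n I) (S : Finset (Fin k)) (g : Chan k m n) {p : Type*}
    [Fintype p] (H : Matrix p (Fin n × Fin m) ℂ) :
    (H * f.VS S g).rank = Module.finrank ℂ ((f.beams S g).map H.mulVecLin) := by
  rw [beams, ← LinearMap.range_comp, ← Matrix.mulVecLin_mul, Matrix.rank]

/-- The stacked channel matrix of receivers `i` and `j`. -/
def pairChan (i j : Fin k) (g : Chan k m n) : Matrix (Fin n ⊕ Fin n) (Fin n × Fin m) ℂ :=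
  Matrix.fromRows (_root_.blockDiag (g i)) (_root_.blockDiag (g j))

lemma recvS_apply (f : Strategy k m n I) (S : Finset (Fin k)) (j : Fin k) (g : Chan k m n)
    (t : Fin n) : (f.recvS S j g).row t = ∑ a, g j t a • (f.VS S g).row (t, a) := by
  ext c
  simp only [Matrix.row, recvS, _root_.blockDiag, Matrix.mul_apply, Fintype.sum_prod_type, Finset.sum_apply,
    Pi.smul_apply, smul_eq_mul, Matrix.of_apply, ite_mul, zero_mul]
  rw [Finset.sum_comm]
  simp

lemma measurable_VS (f : Strategy k m n I) (S : Finset (Fin k)) (r : Fin n × Fin m) :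
    Measurable fun g => (f.VS S g).row r :=
  measurable_pi_lambda _ fun c => f.meas c.1.1 r.1 r.2 c.2

lemma measurable_recvS (f : Strategy k m n I) (S : Finset (Fin k)) (j : Fin k) (t : Fin n) :
    Measurable fun g => (f.recvS S j g).row t := by
  simp only [recvS_apply]
  refine Finset.measurable_sum _ fun a _ =>
    Measurable.fun_smul (f := fun g : Chan k m n => g j t a) ?_ (f.measurable_VS S (t, a))
  fun_prop

/-- The precoders up to time `t` do not see the time-`t` channel of a receiver with delayed
CSIT. -/
lemma VS_update (f : Strategy k m n I) (S : Finset (Fin k)) {d : Fin k} (hd : I d = CSITState.D)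
    (g : Chan k m n) {s t : Fin n} (hst : s ≤ t) (h : Fin m → ℂ) (a : Fin m) :
    (f.VS S (Function.update g d (Function.update (g d) t h))).row (s, a) =
      (f.VS S g).row (s, a) := by
  ext c
  have := f.causal c.1.1 s (Function.update g d (Function.update (g d) t h)) g
    (fun i hi r _ => by
      rw [Function.update_of_ne]
      rintro rfl
      simp [hd] at hi)
    (fun i _ r hr => by
      by_cases hid : i = d
      · subst hid
        rw [Function.update_self, Function.update_of_ne]
        rintro rfl
        exact absurd hst (not_le.2 hr)
      · rw [Function.update_of_ne hid])
  simp [Matrix.row, VS, Vn, this]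

/-- Almost surely, a delayed-CSIT receiver can only miss a transmission at time `t` if it already
knows everything that is transmitted at time `t`. -/
lemma ae_mem_span_past (f : Strategy k m n I) (S : Finset (Fin k)) {d : Fin k}
    (hd : I d = CSITState.D) (μ : Measure ℂ) [IsProbabilityMeasure μ] [NullSingletonClass μ] :
    ∀ᵐ g ∂chanMeasure k m n μ, ∀ t a,
      (f.recvS S d g).row t ∈ Submodule.span ℂ ((f.recvS S d g).row '' Set.Iio t) →
        (f.VS S g).row (t, a) ∈ Submodule.span ℂ ((f.recvS S d g).row '' Set.Iio t) := by
  refine ae_all_iff.2 fun t => ae_all_iff.2 fun a => ?_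
  have hmeas : MeasurableSet {g : Chan k m n |
      (f.recvS S d g).row t ∈ Submodule.span ℂ ((f.recvS S d g).row '' Set.Iio t) →
        (f.VS S g).row (t, a) ∈ Submodule.span ℂ ((f.recvS S d g).row '' Set.Iio t)} := by
    simp only [Set.image_eq_range]
    exact (measurableSet_mem_span (f.measurable_recvS S d t)
      fun s : Set.Iio t => f.measurable_recvS S d s).imp
      (measurableSet_mem_span (f.measurable_VS S (t, a))
      fun s : Set.Iio t => f.measurable_recvS S d s)
  refine ae_pi_of_ae_update d hmeas fun g => ?_
  have hmeas := (measurable_update g (a := d)) hmeas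
  refine ae_pi_of_ae_update t hmeas fun x => ?_
  have hmeas := (measurable_update x (a := t)) hmeas
  refine ae_pi_of_ae_update a hmeas fun h => ?_
  set W := Submodule.span ℂ ((f.recvS S d (Function.update g d x)).row '' Set.Iio t) with hW
  set v : Fin m → _ := fun b => (f.VS S (Function.update g d x)).row (t, b) with hv
  have hVS : ∀ y : Fin m → ℂ, ∀ s ≤ t, ∀ b,
      (f.VS S (Function.update g d (Function.update x t y))).row (s, b) =
        (f.VS S (Function.update g d x)).row (s, b) := by
    intro y s hs b
    simpa using f.VS_update S hd (Function.update g d x) hs y b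
  have hpast : ∀ y : Fin m → ℂ, Submodule.span ℂ
      ((f.recvS S d (Function.update g d (Function.update x t y))).row '' Set.Iio t) = W := by
    intro y
    rw [hW]
    congr 1
    refine Set.image_congr fun s hs => ?_
    simp only [recvS_apply, hVS y s (le_of_lt hs), Function.update_self,
      Function.update_of_ne (Set.mem_Iio.1 hs).ne]
  have hnow : ∀ y : Fin m → ℂ,
      (f.recvS S d (Function.update g d (Function.update x t y))).row t = ∑ b, y b • v b := by
    intro y
    simp only [recvS_apply, hVS y t le_rfl, Function.update_self, hv]
  simp only [hpast, hnow, hVS _ t le_rfl]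
  by_cases hva : v a ∈ W
  · exact Eventually.of_forall fun _ _ => hva
  have hsub : {y : ℂ | ∑ b, Function.update h a y b • v b ∈ W}.Subsingleton := by
    intro y hy z hz
    by_contra hyz
    have hdiff := W.sub_mem hy hz
    rw [← Finset.sum_sub_distrib, Finset.sum_eq_single a (fun b _ hb => by
      simp [Function.update_of_ne hb]) (by simp)] at hdiff
    simp only [Function.update_self, ← sub_smul] at hdiff
    exact hva ((W.smul_mem_iff (sub_ne_zero.2 hyz)).1 hdiff)
  filter_upwards [hsub.countable.ae_notMem μ] with y hy hy'
  exact absurd hy' hy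

/-- Observing any further receiver at most doubles the rank seen by a delayed-CSIT receiver. -/
lemma ae_rank_pairChan_le (f : Strategy k m n I) (S : Finset (Fin k)) {d : Fin k}
    (hd : I d = CSITState.D) (μ : Measure ℂ) [IsProbabilityMeasure μ] [NullSingletonClass μ]
    (j : Fin k) :
    ∀ᵐ g ∂chanMeasure k m n μ, (pairChan j d g * f.VS S g).rank ≤ 2 * (f.recvS S d g).rank := by
  filter_upwards [f.ae_mem_span_past S hd μ] with g hg
  have hrow : Set.range (pairChan j d g * f.VS S g).row =
      Set.range (f.recvS S d g).row ∪ Set.range (f.recvS S j g).row := by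
    rw [Set.union_comm, ← Set.Sum.elim_range, pairChan, Matrix.fromRows_mul]
    congr 1
  rw [Matrix.rank_eq_finrank_span_row, Matrix.rank_eq_finrank_span_row, hrow]
  refine finrank_span_union_le_two_mul _ _ (fun t a => (f.VS S g).row (t, a)) (fun t => ?_)
    fun t ht a => hg t a ht
  rw [recvS_apply]
  exact Submodule.sum_mem _ fun a _ =>
    Submodule.smul_mem _ _ (Submodule.subset_span ⟨a, rfl⟩)

lemma rank_recvS_le_rank_pairChan_left (f : Strategy k m n I) (S : Finset (Fin k)) (i j : Fin k)
    (g : Chan k m n) : (f.recvS S i g).rank ≤ (pairChan i j g * f.VS S g).rank := by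
  rw [Matrix.rank_eq_finrank_span_row, Matrix.rank_eq_finrank_span_row, pairChan,
    Matrix.fromRows_mul]
  refine Submodule.finrank_mono (Submodule.span_mono ?_)
  rintro _ ⟨t, rfl⟩
  exact ⟨Sum.inl t, rfl⟩

lemma rank_recvS_le_rank_pairChan_right (f : Strategy k m n I) (S : Finset (Fin k)) (i j : Fin k)
    (g : Chan k m n) : (f.recvS S j g).rank ≤ (pairChan i j g * f.VS S g).rank := by
  rw [Matrix.rank_eq_finrank_span_row, Matrix.rank_eq_finrank_span_row, pairChan,
    Matrix.fromRows_mul]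
  refine Submodule.finrank_mono (Submodule.span_mono ?_)
  rintro _ ⟨t, rfl⟩
  exact ⟨Sum.inr t, rfl⟩

lemma rank_recvS_mono (f : Strategy k m n I) {S T : Finset (Fin k)} (hST : S ⊆ T) (j : Fin k)
    (g : Chan k m n) : (f.recvS S j g).rank ≤ (f.recvS T j g).rank := by
  rw [recvS, recvS, rank_mul_VS, rank_mul_VS, ← Finset.union_eq_right.2 hST, beams_union]
  exact Submodule.finrank_mono (Submodule.map_mono le_sup_left)

lemma rank_recv1_le (f : Strategy k m n I) (j : Fin k) (g : Chan k m n) :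
    (f.recv1 j g).rank ≤ (f.recvS {j} j g).rank :=
  (f.recvS {j} j g).rank_submatrix_le id fun c => ⟨⟨j, Finset.mem_singleton_self j⟩, c⟩

/-- Decodability at receiver `i` persists when `i` is helped by `j` and the interference is
reduced. -/
lemma dim_add_rank_pairChan_le (f : Strategy k m n I) {i j : Fin k} (S T : Finset (Fin k))
    (g : Chan k m n) (hST : {i} ∪ S ∪ T = Finset.univ) (hrest : S ∪ T = Finset.univ.erase i)
    (hi : (f.recvS Finset.univ i g).rank = f.dim i + (f.recvS (Finset.univ.erase i) i g).rank) :
    f.dim i + (pairChan i j g * f.VS S g).rank ≤ (pairChan i j g * f.VS ({i} ∪ S) g).rank := by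
  rw [← hrest, ← hST] at hi
  set F := (pairChan i j g).mulVecLin with hF
  let p : (Fin n ⊕ Fin n → ℂ) →ₗ[ℂ] (Fin n → ℂ) := LinearMap.funLeft ℂ ℂ Sum.inl
  have hp : ∀ A : Submodule ℂ (Fin n × Fin m → ℂ),
      A.map (_root_.blockDiag (g i)).mulVecLin = (A.map F).map p := by
    intro A
    rw [← Submodule.map_comp]
    congr 1
  rw [recvS, recvS, rank_mul_VS, rank_mul_VS, beams_union _ S, beams_union, beams_union] at hi
  rw [rank_mul_VS, rank_mul_VS, beams_union, ← hF]
  rw [hp, hp] at hi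
  repeat rw [Submodule.map_sup] at hi
  rw [Submodule.map_sup]
  have h1 := Submodule.finrank_sup_add_finrank_le (((f.beams {i} g).map F).map p)
    (((f.beams S g).map F).map p) (((f.beams T g).map F).map p)
  have h2 := Submodule.finrank_map_add_finrank_le
    (le_sup_right : (f.beams S g).map F ≤ (f.beams {i} g).map F ⊔ (f.beams S g).map F) p
  rw [Submodule.map_sup] at h2
  omega

end Strategy

/-- **Converse inequality for 3-user MISO BC when receiver 3 supplies delayed CSIT.**
For any decodable linear coding strategy of block length `n`, almost surely
`m₁(n) + m₂(n)/2 + 2·m₃(n) ≤ 2n`. -/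
theorem three_user_delayed_third_bound (m n : ℕ) (hm : 3 ≤ m)
    (I : Fin 3 → CSITState) (h3 : I 2 = CSITState.D)
    (μ : Measure ℂ) [IsProbabilityMeasure μ] (hac : μ ≪ (volume : Measure ℂ))
    (f : Strategy 3 m n I) (hdec : f.Decodable μ) :
    ∀ᵐ _g ∂ chanMeasure 3 m n μ,
      (f.dim 0 : ℝ) + (f.dim 1 : ℝ) / 2 + 2 * (f.dim 2 : ℝ) ≤ 2 * n := by
  have : NullSingletonClass μ := ⟨fun x => hac (measure_singleton x)⟩
  have : IsProbabilityMeasure (chanMeasure 3 m n μ) := by unfold chanMeasure; infer_instance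
  suffices h : ∀ᵐ _g ∂chanMeasure 3 m n μ, f.dim 0 * 2 + f.dim 1 + 4 * f.dim 2 ≤ 4 * n by
    filter_upwards [h] with _ h
    have : (f.dim 0 : ℝ) * 2 + f.dim 1 + 4 * f.dim 2 ≤ 4 * n := by exact_mod_cast h
    linarith
  filter_upwards [hdec 0, hdec 1, hdec 2, f.ae_rank_pairChan_le {0, 1} h3 μ 0,
    f.ae_rank_pairChan_le {1} h3 μ 1] with g h0 h1 h2 h01 h1'
  have hsub : (f.recvS (Finset.univ.erase 0) 0 g).rank ≤ (f.recvS Finset.univ 0 g).rank :=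
    f.rank_recvS_mono (Finset.erase_subset _ _) 0 g
  have hsub' : (f.recvS (Finset.univ.erase 2) 2 g).rank ≤ (f.recvS Finset.univ 2 g).rank :=
    f.rank_recvS_mono (Finset.erase_subset _ _) 2 g
  have h3e : (Finset.univ.erase 2 : Finset (Fin 3)) = {0, 1} := by decide
  rw [h3e] at h2 hsub'
  have hstep := f.dim_add_rank_pairChan_le (j := 2) {1} {2} g (i := 0) (by decide) (by decide)
    (by omega)
  have hn := (f.recvS Finset.univ 2 g).rank_le_card_height
  rw [Fintype.card_fin] at hn
  have h3left := f.rank_recvS_le_rank_pairChan_right {1} 0 2 g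
  have h1left := f.rank_recvS_le_rank_pairChan_left {1} 1 2 g
  have h1own := f.rank_recv1_le 1 g
  have h01' : ({0} ∪ {1} : Finset (Fin 3)) = {0, 1} := by decide
  rw [h01'] at hstep
  omega

end
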